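/- The Kirchhoff index of the pentagonal graph satisfies Kf(W(G)) = (n + 3m)·( (4/(5n))·Kf(G) + (7/10)·(tr(B1ᵀ·L_G^#·B1) + tr(B2ᵀ·L_G^#·B2)) + (1/2)·(tr(B1ᵀ·L_G^#·B2) + tr(B2ᵀ·L_G^#·B1)) + 5m/2 ) − (9/5)·1ᵀ·(B1 + B2)ᵀ·L_G^#·(B1 + B2)·1 − 5m, where Kf(G) = n·tr(L_G^#). -/

import Mathlib

open Matrix

/-- The Kirchhoff functional does not depend on the choice of {1}-inverse. -/
theorem kirch_indep {N : Type} [Fintype N] [DecidableEq N] [Nonempty N]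
    (L X Y : Matrix N N ℝ) (hLs : L.IsSymm) (hXs : X.IsSymm)
    (hker : ∀ x : N → ℝ, L.mulVec x = 0 → ∃ c, ∀ i, x i = c)
    (hX : L * X * L = L) (hY : L * Y * L = L) :
    (Fintype.card N : ℝ) * trace X - ∑ x, ∑ y, X x y =
      (Fintype.card N : ℝ) * trace Y - ∑ x, ∑ y, Y x y := by
  set J : Matrix N N ℝ := Matrix.of fun _ _ => (1 : ℝ) with hJ
  set K : Matrix N N ℝ := (Fintype.card N : ℝ) • (1 : Matrix N N ℝ) - J with hK
  have hN : (Fintype.card N : ℝ) ≠ 0 := by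
    exact_mod_cast Fintype.card_ne_zero
  have hJJ : J * J = (Fintype.card N : ℝ) • J := by
    ext i j; simp [hJ, Matrix.mul_apply]
  have hKK : K * K = (Fintype.card N : ℝ) • K := by
    simp only [hK, sub_mul, mul_sub, hJJ, smul_mul_assoc, mul_smul_comm, one_mul, mul_one, smul_sub]
    abel
  have hKs : Kᵀ = K := by
    ext i j; simp [hK, hJ, Matrix.one_apply, eq_comm]
  have h0 : L * (X * L - 1) = 0 := by
    rw [mul_sub, ← mul_assoc, hX, mul_one, sub_self]
  have h1 : K * (X * L - 1) = 0 := by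
    ext i j
    obtain ⟨c, hc⟩ := hker (fun k => (X * L - 1) k j) (by
      ext k
      have := congrFun (congrFun h0 k) j
      simpa [Matrix.mul_apply, Matrix.mulVec, dotProduct] using this)
    have : ∀ k, (X * L - 1) k j = c := hc
    rw [Matrix.mul_apply]
    simp only [this, hK, hJ]
    simp [← Finset.sum_mul, Matrix.one_apply]
  have h2 : K * X * L = K := by
    have : K * X * L - K = 0 := by rw [← h1]; noncomm_ring
    exact sub_eq_zero.mp this
  have h3 : L * X * K = K := by
    have := congrArg Matrix.transpose h2
    simp only [Matrix.transpose_mul, hKs, hLs.eq, hXs.eq] at this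
    rw [mul_assoc]; exact this
  have h4 : K * (X - Y) * K = 0 := by
    calc K * (X - Y) * K = (K * X * L) * (X - Y) * (L * X * K) := by rw [h2, h3]
      _ = K * X * (L * X * L - L * Y * L) * X * K := by noncomm_ring
      _ = 0 := by rw [hX, hY]; simp
  have h5 : (Fintype.card N : ℝ) * trace ((X - Y) * K) = 0 := by
    have : trace (K * (X - Y) * K) = 0 := by rw [h4]; simp
    rw [Matrix.trace_mul_comm, ← mul_assoc, hKK, Matrix.smul_mul, trace_smul, smul_eq_mul,
      Matrix.trace_mul_comm] at this
    exact this
  have h6 : ∀ Z : Matrix N N ℝ, trace (Z * K) =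
      (Fintype.card N : ℝ) * trace Z - ∑ x, ∑ y, Z x y := by
    intro Z
    rw [hK, mul_sub, trace_sub, mul_smul_comm, mul_one, trace_smul, smul_eq_mul]
    congr 1
    simp [trace, Matrix.mul_apply, hJ]
  have h7 := (mul_eq_zero.mp h5).resolve_left hN
  rw [sub_mul, trace_sub, h6, h6] at h7
  linarith

theorem trace_blocks_aux {V F : Type} [Fintype V] [Fintype F]
    (A : Matrix V V ℝ) (B : Matrix V F ℝ) (C : Matrix F V ℝ) (D : Matrix F F ℝ) :
    trace (fromBlocks A B C D) = trace A + trace D := by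
  simp [trace, Fintype.sum_sum_type]

/-- Schur complement construction of a {1}-inverse. -/
theorem schur_inv {V F : Type} [Fintype V] [Fintype F] [DecidableEq V] [DecidableEq F]
    (P L Lp : Matrix V V ℝ) (B Q : Matrix V F ℝ) (M N : Matrix F F ℝ)
    (hMN : M * N = 1) (hQ : Q * M = -B) (hQ2 : M * Qᵀ = -Bᵀ) (hBN : B * N = -Q)
    (hS : P + B * Qᵀ = (5 / 4 : ℝ) • L) (hS2 : P + Q * Bᵀ = (5 / 4 : ℝ) • L)
    (hL : L * Lp * L = L) :
    fromBlocks P B Bᵀ M *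
      fromBlocks ((4 / 5 : ℝ) • Lp) ((4 / 5 : ℝ) • (Lp * Q)) ((4 / 5 : ℝ) • (Qᵀ * Lp))
        (N + (4 / 5 : ℝ) • (Qᵀ * Lp * Q)) * fromBlocks P B Bᵀ M = fromBlocks P B Bᵀ M := by
  have hP : P = (5 / 4 : ℝ) • L - B * Qᵀ := by rw [← hS]; abel
  have e1 : fromBlocks P B Bᵀ M *
      fromBlocks ((4 / 5 : ℝ) • Lp) ((4 / 5 : ℝ) • (Lp * Q)) ((4 / 5 : ℝ) • (Qᵀ * Lp))
        (N + (4 / 5 : ℝ) • (Qᵀ * Lp * Q)) = fromBlocks (L * Lp) (L * Lp * Q - Q) 0 1 := by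
    rw [fromBlocks_multiply]
    congr 1
    · simp only [hP, Matrix.sub_mul, Matrix.mul_smul, Matrix.smul_mul, Matrix.mul_assoc]
      module
    · simp only [hP, Matrix.sub_mul, Matrix.mul_add, hBN, Matrix.mul_smul, Matrix.smul_mul,
        Matrix.mul_assoc]
      module
    · rw [Matrix.mul_smul, Matrix.mul_smul, ← Matrix.mul_assoc M, hQ2]
      simp
    · rw [Matrix.mul_add, hMN, Matrix.mul_smul, Matrix.mul_smul, Matrix.mul_assoc Qᵀ,
        ← Matrix.mul_assoc M, hQ2]
      simp
  have hP2 : P = (5 / 4 : ℝ) • L - Q * Bᵀ := by rw [← hS2]; abel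
  rw [e1, fromBlocks_multiply]
  congr 1
  · rw [Matrix.sub_mul, Matrix.mul_assoc (L * Lp) Q Bᵀ]
    conv_lhs => rw [hP2]
    rw [Matrix.mul_sub, Matrix.mul_smul, hL]
    conv_rhs => rw [hP2]
    abel
  · rw [Matrix.sub_mul, Matrix.mul_assoc (L * Lp) Q M, hQ]
    simp
  · simp
  · simp

theorem pent_kirchhoff
    {V E : Type} [Fintype V] [Fintype E] [DecidableEq V] [DecidableEq E]
    [Nonempty V] [Nonempty E]
    (tail head : E → V)
    (hloop : ∀ e, tail e ≠ head e)
    (hsimple : ∀ e f, e ≠ f →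
      ¬(tail e = tail f ∧ head e = head f) ∧ ¬(tail e = head f ∧ head e = tail f))
    (B1 B2 : Matrix V E ℝ)
    (hB1 : B1 = Matrix.of fun i e => if i = tail e then (1 : ℝ) else 0)
    (hB2 : B2 = Matrix.of fun i e => if i = head e then (1 : ℝ) else 0)
    (D_G A_G L_G : Matrix V V ℝ)
    (hD : D_G = B1 * B1ᵀ + B2 * B2ᵀ)
    (hA : A_G = B1 * B2ᵀ + B2 * B1ᵀ)
    (hL : L_G = D_G - A_G)
    (hconn : ∀ x : V → ℝ, L_G.mulVec x = 0 → ∃ c, ∀ i, x i = c)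
    (Lp : Matrix V V ℝ)
    (hLp1 : L_G * Lp * L_G = L_G)
    (hLp2 : Lp * L_G * Lp = Lp)
    (hLp3 : L_G * Lp = Lp * L_G)
    (hLpsymm : Lp.IsSymm)
    (L_W : Matrix (V ⊕ E ⊕ E ⊕ E) (V ⊕ E ⊕ E ⊕ E) ℝ)
    (hLW : L_W = Matrix.fromBlocks ((2 : ℝ) • D_G - A_G)
      (Matrix.fromCols (-B1) (Matrix.fromCols (0 : Matrix V E ℝ) (-B2)))
      (Matrix.fromRows (-B1ᵀ) (Matrix.fromRows (0 : Matrix E V ℝ) (-B2ᵀ)))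
      (Matrix.fromBlocks ((2 : ℝ) • (1 : Matrix E E ℝ))
        (Matrix.fromCols (-(1 : Matrix E E ℝ)) (0 : Matrix E E ℝ))
        (Matrix.fromRows (-(1 : Matrix E E ℝ)) (0 : Matrix E E ℝ))
        (Matrix.fromBlocks ((2 : ℝ) • (1 : Matrix E E ℝ)) (-(1 : Matrix E E ℝ))
          (-(1 : Matrix E E ℝ)) ((2 : ℝ) • (1 : Matrix E E ℝ)))))
    (X : Matrix (V ⊕ E ⊕ E ⊕ E) (V ⊕ E ⊕ E ⊕ E) ℝ)
    (hXsymm : X.IsSymm)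
    (hX : L_W * X * L_W = L_W)
    :
    ((Fintype.card V : ℝ) + 3 * (Fintype.card E : ℝ)) * Matrix.trace X -
        ∑ x, ∑ y, X x y =
      ((Fintype.card V : ℝ) + 3 * (Fintype.card E : ℝ)) *
          ((4 / (5 * (Fintype.card V : ℝ))) * ((Fintype.card V : ℝ) * Matrix.trace Lp) +
            (7/10 : ℝ) * (Matrix.trace (B1ᵀ * Lp * B1) + Matrix.trace (B2ᵀ * Lp * B2)) +
            (1/2 : ℝ) * (Matrix.trace (B1ᵀ * Lp * B2) + Matrix.trace (B2ᵀ * Lp * B1)) +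
            5 * (Fintype.card E : ℝ) / 2) -
        (9/5 : ℝ) * ∑ e, ∑ f, ((B1 + B2)ᵀ * Lp * (B1 + B2)) e f -
        5 * (Fintype.card E : ℝ) := by
  have hrow1 : ∀ e, ∑ i, B1 i e = 1 := by intro e; simp [hB1]
  have hrow2 : ∀ e, ∑ i, B2 i e = 1 := by intro e; simp [hB2]
  have hLf : L_G = (B1 - B2) * (B1 - B2)ᵀ := by
    rw [hL, hD, hA, transpose_sub, Matrix.sub_mul, Matrix.mul_sub, Matrix.mul_sub]; abel
  have hL1 : L_G *ᵥ (fun _ => (1 : ℝ)) = 0 := by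
    rw [hLf, ← Matrix.mulVec_mulVec]
    have : (B1 - B2)ᵀ *ᵥ (fun _ => (1 : ℝ)) = 0 := by
      ext e; simp [Matrix.mulVec, dotProduct, hrow1, hrow2]
    rw [this, Matrix.mulVec_zero]
  have hLp0 : Lp *ᵥ (fun _ => (1 : ℝ)) = 0 := by
    rw [← hLp2, Matrix.mul_assoc, hLp3, ← Matrix.mul_assoc, ← Matrix.mulVec_mulVec, hL1,
      Matrix.mulVec_zero]
  have hLpr : ∀ i, ∑ j, Lp i j = 0 := by
    intro i; simpa [Matrix.mulVec, dotProduct] using congrFun hLp0 i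
  have hLpc : ∀ j, ∑ i, Lp i j = 0 := by
    intro j; rw [← hLpr j]
    exact Finset.sum_congr rfl fun i _ => hLpsymm.apply j i
  have hLs : L_Gᵀ = L_G := by rw [hLf, transpose_mul, transpose_transpose]
  set B : Matrix V (E ⊕ E ⊕ E) ℝ :=
    fromCols (-B1) (fromCols (0 : Matrix V E ℝ) (-B2)) with hB
  set M : Matrix (E ⊕ E ⊕ E) (E ⊕ E ⊕ E) ℝ := (Matrix.fromBlocks ((2 : ℝ) • (1 : Matrix E E ℝ))
        (Matrix.fromCols (-(1 : Matrix E E ℝ)) (0 : Matrix E E ℝ))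
        (Matrix.fromRows (-(1 : Matrix E E ℝ)) (0 : Matrix E E ℝ))
        (Matrix.fromBlocks ((2 : ℝ) • (1 : Matrix E E ℝ)) (-(1 : Matrix E E ℝ))
          (-(1 : Matrix E E ℝ)) ((2 : ℝ) • (1 : Matrix E E ℝ)))) with hM
  set Q1 : Matrix V E ℝ := (3 / 4 : ℝ) • B1 + (1 / 4 : ℝ) • B2 with hQ1
  set Q2 : Matrix V E ℝ := (1 / 2 : ℝ) • B1 + (1 / 2 : ℝ) • B2 with hQ2
  set Q3 : Matrix V E ℝ := (1 / 4 : ℝ) • B1 + (3 / 4 : ℝ) • B2 with hQ3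
  set Q : Matrix V (E ⊕ E ⊕ E) ℝ := fromCols Q1 (fromCols Q2 Q3) with hQ
  set N : Matrix (E ⊕ E ⊕ E) (E ⊕ E ⊕ E) ℝ :=
    fromBlocks ((3 / 4 : ℝ) • (1 : Matrix E E ℝ))
      (fromCols ((1 / 2 : ℝ) • (1 : Matrix E E ℝ)) ((1 / 4 : ℝ) • (1 : Matrix E E ℝ)))
      (fromRows ((1 / 2 : ℝ) • (1 : Matrix E E ℝ)) ((1 / 4 : ℝ) • (1 : Matrix E E ℝ)))
      (fromBlocks (1 : Matrix E E ℝ) ((1 / 2 : ℝ) • (1 : Matrix E E ℝ))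
        ((1 / 2 : ℝ) • (1 : Matrix E E ℝ)) ((3 / 4 : ℝ) • (1 : Matrix E E ℝ))) with hN
  have hBt : Bᵀ = fromRows (-B1ᵀ) (fromRows (0 : Matrix E V ℝ) (-B2ᵀ)) := by
    rw [hB, transpose_fromCols, transpose_fromCols]; simp
  have hQt : Qᵀ = fromRows Q1ᵀ (fromRows Q2ᵀ Q3ᵀ) := by
    rw [hQ, transpose_fromCols, transpose_fromCols]
  have hMs : Mᵀ = M := by
    ext (i | i | i) (j | j | j) <;> simp [hM, Matrix.one_apply, eq_comm]
  have hMN : M * N = 1 := by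
    ext (i | i | i) (j | j | j) <;>
      simp [hM, hN, Matrix.mul_apply, Fintype.sum_sum_type, Matrix.one_apply] <;>
      split_ifs <;> norm_num
  have hQM : Q * M = -B := by
    ext i (j | j | j) <;>
      simp [hM, hQ, hB, hQ1, hQ2, hQ3, Matrix.mul_apply, Fintype.sum_sum_type, Matrix.one_apply] <;>
      ring
  have hBN : B * N = -Q := by
    ext i (j | j | j) <;>
      simp [hN, hQ, hB, hQ1, hQ2, hQ3, Matrix.mul_apply, Fintype.sum_sum_type, Matrix.one_apply] <;>
      ring
  have hMQ : M * Qᵀ = -Bᵀ := by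
    have := congrArg Matrix.transpose hQM
    simpa [transpose_mul, hMs] using this
  have hS : ((2 : ℝ) • D_G - A_G) + B * Qᵀ = (5 / 4 : ℝ) • L_G := by
    rw [hQt, hB, fromCols_mul_fromRows, fromCols_mul_fromRows, hL, hD, hA]
    simp only [hQ1, hQ3, transpose_add, transpose_smul, Matrix.mul_add, Matrix.neg_mul,
      Matrix.mul_smul, Matrix.zero_mul]
    module
  have hS2 : ((2 : ℝ) • D_G - A_G) + Q * Bᵀ = (5 / 4 : ℝ) • L_G := by
    rw [hBt, hQ, fromCols_mul_fromRows, fromCols_mul_fromRows, hL, hD, hA]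
    simp only [hQ1, hQ3, Matrix.add_mul, Matrix.smul_mul, Matrix.mul_neg, Matrix.mul_zero]
    module
  have hY := schur_inv ((2 : ℝ) • D_G - A_G) L_G Lp B Q M N hMN hQM hMQ hBN hS hS2 hLp1
  rw [← hBt] at hLW
  rw [← hLW] at hY
  have hPs : ((2 : ℝ) • D_G - A_G)ᵀ = (2 : ℝ) • D_G - A_G := by
    rw [hD, hA]; simp [transpose_mul]; abel
  have hLWs : L_W.IsSymm := by
    unfold Matrix.IsSymm
    rw [hLW, fromBlocks_transpose, hPs, hMs, transpose_transpose]
  have hNM : N * M = 1 := mul_eq_one_comm.mp hMN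
  have hNBt : N * Bᵀ = -Qᵀ := by
    have : N * (M * Qᵀ) = N * (-Bᵀ) := by rw [hMQ]
    rw [← Matrix.mul_assoc, hNM, Matrix.one_mul, Matrix.mul_neg] at this
    rw [this, neg_neg]
  have hker : ∀ x : V ⊕ E ⊕ E ⊕ E → ℝ, L_W.mulVec x = 0 → ∃ c, ∀ i, x i = c := by
    intro x hx
    rw [hLW, fromBlocks_mulVec] at hx
    have k1 : ((2 : ℝ) • D_G - A_G) *ᵥ (x ∘ Sum.inl) + B *ᵥ (x ∘ Sum.inr) = 0 := by
      ext i; exact congrFun hx (Sum.inl i)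
    have k2 : Bᵀ *ᵥ (x ∘ Sum.inl) + M *ᵥ (x ∘ Sum.inr) = 0 := by
      ext i; exact congrFun hx (Sum.inr i)
    have k3 : x ∘ Sum.inr = Qᵀ *ᵥ (x ∘ Sum.inl) := by
      have := congrArg (fun z => N *ᵥ z) k2
      simp only [Matrix.mulVec_add, Matrix.mulVec_mulVec, hNM, hNBt, Matrix.one_mulVec,
        Matrix.neg_mulVec, Matrix.mulVec_zero] at this
      rw [neg_add_eq_zero] at this
      exact this.symm
    rw [k3, Matrix.mulVec_mulVec, ← Matrix.add_mulVec, hS, Matrix.smul_mulVec] at k1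
    obtain ⟨c, hc⟩ := hconn _ ((smul_eq_zero.mp k1).resolve_left (by norm_num))
    refine ⟨c, ?_⟩
    have hc' : ∀ i, x (Sum.inl i) = c := hc
    have k4 : ∀ f, x (Sum.inr f) = ∑ i, Q i f * c := by
      intro f
      have := congrFun k3 f
      simpa [Matrix.mulVec, dotProduct, hc'] using this
    rintro (i | e | e | e)
    · exact hc' i
    all_goals
      rw [k4, ← Finset.sum_mul]
      simp [hQ, hQ1, hQ2, hQ3, Finset.sum_add_distrib, ← Finset.mul_sum, hrow1, hrow2]
      ring_nf
      try simp
  have key := kirch_indep L_W X _ hLWs hXsymm hker hX hY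
  have hcard : (Fintype.card (V ⊕ E ⊕ E ⊕ E) : ℝ) =
      (Fintype.card V : ℝ) + 3 * (Fintype.card E : ℝ) := by
    simp only [Fintype.card_sum]; push_cast; ring
  rw [hcard] at key
  rw [key]
  have hn : (Fintype.card V : ℝ) ≠ 0 := by exact_mod_cast Fintype.card_ne_zero
  have htr : trace (fromBlocks ((4 / 5 : ℝ) • Lp) ((4 / 5 : ℝ) • (Lp * Q))
      ((4 / 5 : ℝ) • (Qᵀ * Lp)) (N + (4 / 5 : ℝ) • (Qᵀ * Lp * Q))) =
      (4 / 5) * trace Lp +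
            (7/10 : ℝ) * (Matrix.trace (B1ᵀ * Lp * B1) + Matrix.trace (B2ᵀ * Lp * B2)) +
            (1/2 : ℝ) * (Matrix.trace (B1ᵀ * Lp * B2) + Matrix.trace (B2ᵀ * Lp * B1)) +
            5 * (Fintype.card E : ℝ) / 2 := by
    have t1 : trace N = 5 * (Fintype.card E : ℝ) / 2 := by
      simp [hN, trace_blocks_aux]; ring
    have t2 : trace (Qᵀ * Lp * Q) = trace (Q1ᵀ * Lp * Q1) + trace (Q2ᵀ * Lp * Q2)
        + trace (Q3ᵀ * Lp * Q3) := by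
      simp [trace, hQ, Fintype.sum_sum_type, Matrix.mul_apply]
      ring
    rw [trace_blocks_aux, trace_add, trace_smul, trace_smul, t1, t2]
    simp only [hQ1, hQ2, hQ3, transpose_add, transpose_smul, Matrix.add_mul, Matrix.mul_add,
      Matrix.smul_mul, Matrix.mul_smul, trace_add, trace_smul, smul_eq_mul]
    ring
  have hsum : ∑ x, ∑ y, (fromBlocks ((4 / 5 : ℝ) • Lp) ((4 / 5 : ℝ) • (Lp * Q))
      ((4 / 5 : ℝ) • (Qᵀ * Lp)) (N + (4 / 5 : ℝ) • (Qᵀ * Lp * Q))) x y =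
      (9/5 : ℝ) * ∑ e, ∑ f, ((B1 + B2)ᵀ * Lp * (B1 + B2)) e f +
        5 * (Fintype.card E : ℝ) := by
    have s1 : ∑ i, ∑ j, Lp i j = 0 := by simp [hLpr]
    have s2 : ∑ i, ∑ f, (Lp * Q) i f = 0 := by
      refine Finset.sum_comm.trans ?_
      refine Finset.sum_eq_zero fun f _ => ?_
      simp only [Matrix.mul_apply]
      rw [Finset.sum_comm]
      simp [← Finset.sum_mul, hLpc]
    have s3 : ∑ f, ∑ i, (Qᵀ * Lp) f i = 0 := by
      refine Finset.sum_eq_zero fun f _ => ?_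
      simp only [Matrix.mul_apply]
      rw [Finset.sum_comm]
      simp [← Finset.mul_sum, hLpr]
    have s4 : ∑ f, ∑ g, N f g = 5 * (Fintype.card E : ℝ) := by
      simp [hN, Fintype.sum_sum_type, Matrix.one_apply, Finset.sum_add_distrib]
      ring
    have gen : ∀ {F : Type} [Fintype F] (R : Matrix V F ℝ),
        ∑ f, ∑ g, (Rᵀ * Lp * R) f g = (R *ᵥ fun _ => 1) ⬝ᵥ (Lp *ᵥ (R *ᵥ fun _ => 1)) := by
      intro F _ R
      have : ∑ f, ∑ g, (Rᵀ * Lp * R) f g =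
          (fun _ => (1 : ℝ)) ⬝ᵥ ((Rᵀ * Lp * R) *ᵥ fun _ => (1 : ℝ)) := by
        simp [Matrix.mulVec, dotProduct]
      rw [this, ← Matrix.mulVec_mulVec, ← Matrix.mulVec_mulVec, Matrix.dotProduct_mulVec,
        Matrix.vecMul_transpose]
    have s5 : (Q *ᵥ fun _ => (1 : ℝ)) = (3 / 2 : ℝ) • ((B1 + B2) *ᵥ fun _ => (1 : ℝ)) := by
      ext i
      simp [Matrix.mulVec, dotProduct, hQ, hQ1, hQ2, hQ3, Fintype.sum_sum_type,
        Finset.sum_add_distrib, ← Finset.mul_sum]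
      ring
    rw [Fintype.sum_sum_type]
    simp only [Fintype.sum_sum_type (α₁ := V), fromBlocks_apply₁₁, fromBlocks_apply₁₂,
      fromBlocks_apply₂₁, fromBlocks_apply₂₂, Matrix.smul_apply, Matrix.add_apply, smul_eq_mul,
      Finset.sum_add_distrib, ← Finset.mul_sum]
    rw [s1, s2, s3, s4, gen, gen, s5, Matrix.mulVec_smul, smul_dotProduct, dotProduct_smul]
    simp only [smul_eq_mul]
    ring
  rw [htr, hsum]
  field_simp
  ring
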